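/- If φ is a first-order goal formula and its interpretation over the descending chain ↓Φ_P is the top chain, ⟦φ⟧_{↓Φ_P} = ⊤̇, then its interpretation in the complete Herbrand model is true: ⟦φ⟧_{M(P)} = ⊤. -/

import Mathlib

/-! ## Simple types with a single base type `ι` -/

/-- Simple types over the single base type `ι`. -/
inductive Ty : Type
  | base : Ty
  | arrow : Ty → Ty → Ty

/-- The order of a type: `ord ι = 0`, `ord (σ→τ) = max (ord σ + 1) (ord τ)`. -/
def Ty.order : Ty → ℕ
  | .base => 0
  | .arrow σ τ => max (σ.order + 1) τ.order

/-- The arity of a (first-order) type: `ar ι = 0`, `ar (ι→τ) = ar τ + 1`. -/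
def Ty.arity : Ty → ℕ
  | .base => 0
  | .arrow _ τ => τ.arity + 1

/-- A term signature assigns types to (some) constant names. -/
abbrev Sig : Type := String → Option Ty

/-- A signature is first-order if every symbol has a type of order ≤ 1. -/
def Sig.FirstOrder (Sg : Sig) : Prop := ∀ c τ, Sg c = some τ → τ.order ≤ 1

/-- The arity of a symbol of a (first-order) signature. -/
def Sig.ar (Sg : Sig) (c : String) : ℕ := ((Sg c).map Ty.arity).getD 0

/-! ## Terms (de Bruijn representation) -/

/-- Terms of the simply typed λ-calculus with constants and a fixed point
operator `fix`, in de Bruijn representation. -/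
inductive Tm : Type
  | var : ℕ → Tm
  | const : String → Tm
  | app : Tm → Tm → Tm
  | lam : Ty → Tm → Tm
  | fix : Ty → Tm → Tm

/-- Shift ("weakening") of de Bruijn indices `≥ c` by `d`. -/
def Tm.shift (d : ℕ) : ℕ → Tm → Tm
  | c, .var n => if n < c then .var n else .var (n + d)
  | _, .const f => .const f
  | c, .app M N => .app (Tm.shift d c M) (Tm.shift d c N)
  | c, .lam τ M => .lam τ (Tm.shift d (c + 1) M)
  | c, .fix τ M => .fix τ (Tm.shift d (c + 1) M)

/-- Capture-avoiding substitution `Tm.subst k N M = M[N/k]` of the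
de Bruijn variable `k` by `N` in `M`. -/
def Tm.subst : ℕ → Tm → Tm → Tm
  | k, N, .var n => if n = k then Tm.shift k 0 N else if k < n then .var (n - 1) else .var n
  | _, _, .const f => .const f
  | k, N, .app M₁ M₂ => .app (Tm.subst k N M₁) (Tm.subst k N M₂)
  | k, N, .lam τ M => .lam τ (Tm.subst (k + 1) N M)
  | k, N, .fix τ M => .fix τ (Tm.subst (k + 1) N M)

/-- Typing contexts: lists of types (the head is de Bruijn index 0). -/
abbrev Ctx : Type := List Ty

/-- Typing judgement `Γ ⊢ M : τ` over the signature `Sg`. -/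
inductive HasTy (Sg : Sig) : Ctx → Tm → Ty → Prop
  | var {Γ n τ} : Γ[n]? = some τ → HasTy Sg Γ (.var n) τ
  | const {Γ c τ} : Sg c = some τ → HasTy Sg Γ (.const c) τ
  | app {Γ M N σ τ} : HasTy Sg Γ M (.arrow σ τ) → HasTy Sg Γ N σ → HasTy Sg Γ (.app M N) τ
  | lam {Γ M σ τ} : HasTy Sg (σ :: Γ) M τ → HasTy Sg Γ (.lam σ M) (.arrow σ τ)
  | fixI {Γ M τ} : HasTy Sg (τ :: Γ) M τ → HasTy Sg Γ (.fix τ M) τ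

/-- `lams n M` is the `n`-fold λ-abstraction `λ y₁ … yₙ. M` (all of base type). -/
def lams : ℕ → Tm → Tm
  | 0, M => M
  | n + 1, M => .lam .base (lams n M)

/-- `apps M [N₁, …, Nₙ]` is the iterated application `M N₁ … Nₙ`. -/
def apps : Tm → List Tm → Tm
  | M, [] => M
  | M, N :: Ns => apps (.app M N) Ns

/-- Guarded base terms `Γ ⊢g M : τ`. -/
inductive GBase (Sg : Sig) : Ctx → Tm → Ty → Prop
  | var {Γ n τ} : Γ[n]? = some τ → τ.order ≤ 1 → GBase Sg Γ (.var n) τ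
  | const {Γ c τ} : Sg c = some τ → GBase Sg Γ (.const c) τ
  | app {Γ M N σ τ} : GBase Sg Γ M (.arrow σ τ) → GBase Sg Γ N σ → GBase Sg Γ (.app M N) τ
  | fixI {Γ f σf τ Ms} : Sg f = some σf → τ.order ≤ 1 →
      Ms.length = σf.arity →
      (∀ M ∈ Ms, GBase Sg (List.replicate τ.arity Ty.base ++ τ :: Γ) M .base) →
      GBase Sg Γ (.fix τ (lams τ.arity (apps (.const f) Ms))) τ

/-- Guarded terms: generated from closed guarded base terms, constants and
variables by application and λ-abstraction (equivalently: all `fix`-subterms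
occur inside closed guarded base subterms). -/
inductive Guarded (Sg : Sig) : Tm → Prop
  | base {M τ} : GBase Sg [] M τ → Guarded Sg M
  | const {c} : Guarded Sg (.const c)
  | var {n} : Guarded Sg (.var n)
  | app {M N} : Guarded Sg M → Guarded Sg N → Guarded Sg (.app M N)
  | lam {τ M} : Guarded Sg M → Guarded Sg (.lam τ M)

/-! ## Reduction and conversion -/

/-- One-step β/fix-reduction (compatible closure). -/
inductive Red : Tm → Tm → Prop
  | beta {τ M N} : Red (.app (.lam τ M) N) (Tm.subst 0 N M)
  | fixUnfold {τ M} : Red (.fix τ M) (Tm.subst 0 (.fix τ M) M)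
  | appL {M M' N} : Red M M' → Red (.app M N) (.app M' N)
  | appR {M N N'} : Red N N' → Red (.app M N) (.app M N')
  | lam {τ M M'} : Red M M' → Red (.lam τ M) (.lam τ M')
  | fixC {τ M M'} : Red M M' → Red (.fix τ M) (.fix τ M')

/-- Multi-step reduction `↠`. -/
def RedStar : Tm → Tm → Prop := Relation.ReflTransGen Red

/-- Convertibility: equivalence closure of reduction. -/
def Conv : Tm → Tm → Prop := Relation.EqvGen Red
/-! ## Formulae and the logic iFOLm -/

/-- First-order formulae over λ-terms, with atoms `p M₁ … Mₙ` and the later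
modality `▷` (de Bruijn representation for quantifiers). -/
inductive Fm : Type
  | atom : String → List Tm → Fm
  | top : Fm
  | conj : Fm → Fm → Fm
  | disj : Fm → Fm → Fm
  | impl : Fm → Fm → Fm
  | all : Ty → Fm → Fm
  | ex : Ty → Fm → Fm
  | later : Fm → Fm

/-- Shifting of de Bruijn indices in a formula. -/
def Fm.shift (d : ℕ) : ℕ → Fm → Fm
  | c, .atom p Ms => .atom p (Ms.map (Tm.shift d c))
  | _, .top => .top
  | c, .conj φ ψ => .conj (Fm.shift d c φ) (Fm.shift d c ψ)
  | c, .disj φ ψ => .disj (Fm.shift d c φ) (Fm.shift d c ψ)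
  | c, .impl φ ψ => .impl (Fm.shift d c φ) (Fm.shift d c ψ)
  | c, .all τ φ => .all τ (Fm.shift d (c + 1) φ)
  | c, .ex τ φ => .ex τ (Fm.shift d (c + 1) φ)
  | c, .later φ => .later (Fm.shift d c φ)

/-- Substitution `φ[N/k]` of a term for a de Bruijn variable in a formula. -/
def Fm.subst : ℕ → Tm → Fm → Fm
  | k, N, .atom p Ms => .atom p (Ms.map (Tm.subst k N))
  | _, _, .top => .top
  | k, N, .conj φ ψ => .conj (Fm.subst k N φ) (Fm.subst k N ψ)
  | k, N, .disj φ ψ => .disj (Fm.subst k N φ) (Fm.subst k N ψ)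
  | k, N, .impl φ ψ => .impl (Fm.subst k N φ) (Fm.subst k N ψ)
  | k, N, .all τ φ => .all τ (Fm.subst (k + 1) N φ)
  | k, N, .ex τ φ => .ex τ (Fm.subst (k + 1) N φ)
  | k, N, .later φ => .later (Fm.subst k N φ)

/-- Conversion of formulae: congruence closure of term convertibility. -/
inductive FmConv : Fm → Fm → Prop
  | atom {p Ms Ns} : List.Forall₂ Conv Ms Ns → FmConv (.atom p Ms) (.atom p Ns)
  | top : FmConv .top .top
  | conj {φ φ' ψ ψ'} : FmConv φ φ' → FmConv ψ ψ' → FmConv (.conj φ ψ) (.conj φ' ψ')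
  | disj {φ φ' ψ ψ'} : FmConv φ φ' → FmConv ψ ψ' → FmConv (.disj φ ψ) (.disj φ' ψ')
  | impl {φ φ' ψ ψ'} : FmConv φ φ' → FmConv ψ ψ' → FmConv (.impl φ ψ) (.impl φ' ψ')
  | all {τ φ φ'} : FmConv φ φ' → FmConv (.all τ φ) (.all τ φ')
  | ex {τ φ φ'} : FmConv φ φ' → FmConv (.ex τ φ) (.ex τ φ')
  | later {φ φ'} : FmConv φ φ' → FmConv (.later φ) (.later φ')

/-- The sequent calculus (natural deduction) of the logic `iFOLm`:
intuitionistic first-order logic over guarded terms, extended with the later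
modality `▷` and the rules Next, Mon and Löb.  A sequent `IPrf Sg Γ Δ φ`
corresponds to `Σ; Γ; Δ ⊢ φ`. -/
inductive IPrf (Sg : Sig) : Ctx → Set Fm → Fm → Prop
  | proj {Γ Δ φ} : φ ∈ Δ → IPrf Sg Γ Δ φ
  | conv {Γ Δ φ φ'} : IPrf Sg Γ Δ φ' → FmConv φ φ' → IPrf Sg Γ Δ φ
  | topI {Γ Δ} : IPrf Sg Γ Δ .top
  | andI {Γ Δ φ ψ} : IPrf Sg Γ Δ φ → IPrf Sg Γ Δ ψ → IPrf Sg Γ Δ (.conj φ ψ)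
  | andE1 {Γ Δ φ ψ} : IPrf Sg Γ Δ (.conj φ ψ) → IPrf Sg Γ Δ φ
  | andE2 {Γ Δ φ ψ} : IPrf Sg Γ Δ (.conj φ ψ) → IPrf Sg Γ Δ ψ
  | orI1 {Γ Δ φ ψ} : IPrf Sg Γ Δ φ → IPrf Sg Γ Δ (.disj φ ψ)
  | orI2 {Γ Δ φ ψ} : IPrf Sg Γ Δ ψ → IPrf Sg Γ Δ (.disj φ ψ)
  | orE {Γ Δ φ₁ φ₂ ψ} : IPrf Sg Γ (insert φ₁ Δ) ψ → IPrf Sg Γ (insert φ₂ Δ) ψ →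
      IPrf Sg Γ (insert (.disj φ₁ φ₂) Δ) ψ
  | implI {Γ Δ φ ψ} : IPrf Sg Γ (insert φ Δ) ψ → IPrf Sg Γ Δ (.impl φ ψ)
  | implE {Γ Δ φ ψ} : IPrf Sg Γ Δ (.impl φ ψ) → IPrf Sg Γ Δ φ → IPrf Sg Γ Δ ψ
  | allI {Γ Δ τ φ} : IPrf Sg (τ :: Γ) (Fm.shift 1 0 '' Δ) φ → IPrf Sg Γ Δ (.all τ φ)
  | allE {Γ Δ τ φ M} : IPrf Sg Γ Δ (.all τ φ) → Guarded Sg M → HasTy Sg Γ M τ →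
      IPrf Sg Γ Δ (Fm.subst 0 M φ)
  | exI {Γ Δ τ φ M} : Guarded Sg M → HasTy Sg Γ M τ → IPrf Sg Γ Δ (Fm.subst 0 M φ) →
      IPrf Sg Γ Δ (.ex τ φ)
  | exE {Γ Δ τ φ ψ} :
      IPrf Sg (τ :: Γ) (insert φ (Fm.shift 1 0 '' Δ)) (Fm.shift 1 0 ψ) →
      IPrf Sg Γ (insert (.ex τ φ) Δ) ψ
  | next {Γ Δ φ} : IPrf Sg Γ Δ φ → IPrf Sg Γ Δ (.later φ)
  | mon {Γ Δ φ ψ} : IPrf Sg Γ Δ (.later (.impl φ ψ)) →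
      IPrf Sg Γ Δ (.impl (.later φ) (.later ψ))
  | lob {Γ Δ φ} : IPrf Sg Γ (insert (.later φ) Δ) φ → IPrf Sg Γ Δ φ

/-- `fix`-freeness of a term. -/
def Tm.NoFix : Tm → Prop
  | .fix _ _ => False
  | .app M N => M.NoFix ∧ N.NoFix
  | .lam _ M => M.NoFix
  | _ => True

/-- Predicate signatures: a predicate name is assigned its list of argument types. -/
abbrev PSig : Type := String → Option (List Ty)
/-! ## Coterms and the complete Herbrand base -/

/-- The polynomial functor `X ↦ ⟦Σ⟧(X) + V` of a first-order signature,
with a set `V` of variables. -/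
def coSig (Sg : Sig) (V : Type) : PFunctor.{0} where
  A := String ⊕ V
  B := fun a => match a with
    | Sum.inl c => Fin (Sg.ar c)
    | Sum.inr _ => Empty

/-- Coterms over `Σ` and variables `V`: the final coalgebra (M-type) of
`⟦Σ⟧(-) + V`; `PFunctor.M.dest` is the structure map `root`. -/
def CoTerm (Sg : Sig) (V : Type) : Type := (coSig Sg V).M

/-- Ground coterms: the complete Herbrand universe. -/
abbrev GCoTerm (Sg : Sig) : Type := CoTerm Sg Empty

/-- One step of the substitution coalgebra used to define `csubst`. -/
noncomputable def substStep {Sg : Sig} (θ : ℕ → GCoTerm Sg) :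
    (CoTerm Sg ℕ ⊕ GCoTerm Sg) → (coSig Sg Empty).Obj (CoTerm Sg ℕ ⊕ GCoTerm Sg)
  | Sum.inl t =>
    match PFunctor.M.dest t with
    | ⟨Sum.inl f, k⟩ => ⟨Sum.inl f, fun i => Sum.inl (k i)⟩
    | ⟨Sum.inr v, _⟩ =>
      match PFunctor.M.dest (θ v) with
      | ⟨Sum.inl f, k⟩ => ⟨Sum.inl f, fun i => Sum.inr (k i)⟩
      | ⟨Sum.inr e, _⟩ => e.elim
  | Sum.inr t =>
    match PFunctor.M.dest t with
    | ⟨Sum.inl f, k⟩ => ⟨Sum.inl f, fun i => Sum.inr (k i)⟩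
    | ⟨Sum.inr e, _⟩ => e.elim

/-- Substitution of ground coterms for the variables of a coterm
(the Kleisli structure of the free completely iterative monad). -/
noncomputable def csubst {Sg : Sig} (t : CoTerm Sg ℕ) (θ : ℕ → GCoTerm Sg) : GCoTerm Sg :=
  PFunctor.M.corec (substStep θ) (Sum.inl t)

/-- The complete Herbrand base: atoms `p(t₁, …, tₙ)` over ground coterms. -/
abbrev HBase (Sg : Sig) : Type := String × List (GCoTerm Sg)

/-- A specification of the coterm semantics `⟦-⟧` of (first-order guarded)
terms: it identifies convertible terms and sends a term to the tree determined
by its head normal forms. -/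
def SemSpec (Sg : Sig) (sem : Tm → CoTerm Sg ℕ) : Prop :=
  (∀ M N, Conv M N → sem M = sem N) ∧
  (∀ M f Ns (h : Ns.length = Sg.ar f),
    (∀ N ∈ Ns, Guarded Sg N) →
    RedStar M (apps (.const f) Ns) →
    PFunctor.M.dest (sem M) = ⟨Sum.inl f, fun i => sem (Ns.get (Fin.cast h.symm i))⟩) ∧
  (∀ M x, RedStar M (.var x) →
    PFunctor.M.dest (sem M) = ⟨Sum.inr x, fun e => e.elim⟩)

/-! ## Atoms, Horn clauses and the Herbrand model -/

/-- Syntactic atoms `p M₁ … Mₙ`. -/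
structure Atm : Type where
  p : String
  args : List Tm

/-- The element `⟦A⟧[θ]` of the Herbrand base determined by an atom `A`, the
coterm semantics `sem` of terms and a ground substitution `θ`. -/
noncomputable def Atm.gsem {Sg : Sig} (sem : Tm → CoTerm Sg ℕ) (θ : ℕ → GCoTerm Sg)
    (A : Atm) : HBase Sg :=
  (A.p, A.args.map fun M => csubst (sem M) θ)

/-- A clause `∀x₁ … x_n. A₁ ∧ … ∧ A_q → A₀` (de Bruijn: the variables of the
atoms range over `0, …, n-1`). -/
structure HClause : Type where
  n : ℕ
  body : List Atm
  head : Atm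

/-- Well-formedness of a guarded first-order atom in a context of `n`
base-typed variables. -/
def Atm.WFg (Sg : Sig) (Pg : PSig) (n : ℕ) (A : Atm) : Prop :=
  ∃ τs, Pg A.p = some τs ∧ (∀ τ ∈ τs, τ = Ty.base) ∧
    List.Forall₂ (fun M τ => Guarded Sg M ∧ HasTy Sg (List.replicate n .base) M τ)
      A.args τs

/-- `H^g`-formulae: clauses whose atoms are first-order guarded atoms. -/
def HClause.WFg (Sg : Sig) (Pg : PSig) (C : HClause) : Prop :=
  C.head.WFg Sg Pg C.n ∧ ∀ A ∈ C.body, A.WFg Sg Pg C.n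

/-- Well-formedness of a fix-free (simple) first-order atom. -/
def Atm.WFh (Sg : Sig) (Pg : PSig) (n : ℕ) (A : Atm) : Prop :=
  (∀ M ∈ A.args, Tm.NoFix M) ∧ A.WFg Sg Pg n

/-- `H`-formulae: Horn clauses with fix-free first-order atoms. -/
def HClause.WFh (Sg : Sig) (Pg : PSig) (C : HClause) : Prop :=
  C.head.WFh Sg Pg C.n ∧ ∀ A ∈ C.body, A.WFh Sg Pg C.n

/-- The monotone operator `Φ_P` on interpretations `I ⊆ 𝔅` determined by a
set `P` of clauses. -/
noncomputable def PhiP {Sg : Sig} (P : Set HClause) (sem : Tm → CoTerm Sg ℕ)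
    (I : Set (HBase Sg)) : Set (HBase Sg) :=
  { a | ∃ C ∈ P, ∃ θ : ℕ → GCoTerm Sg,
      a = C.head.gsem sem θ ∧ ∀ B ∈ C.body, B.gsem sem θ ∈ I }

theorem PhiP_mono {Sg : Sig} (P : Set HClause) (sem : Tm → CoTerm Sg ℕ) :
    Monotone (PhiP P sem) := by
  intro I J hIJ a ha
  obtain ⟨C, hC, θ, ha, hb⟩ := ha
  exact ⟨C, hC, θ, ha, fun B hB => hIJ (hb B hB)⟩

/-- The complete Herbrand model `M(P)`: the greatest fixed point of `Φ_P`. -/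
noncomputable def HModel {Sg : Sig} (P : Set HClause) (sem : Tm → CoTerm Sg ℕ) :
    Set (HBase Sg) :=
  OrderHom.gfp ⟨PhiP P sem, PhiP_mono P sem⟩

/-- `mkAll n φ = ∀x₁ … ∀xₙ. φ` (all quantifiers over the base type `ι`). -/
def mkAll : ℕ → Fm → Fm
  | 0, φ => φ
  | n + 1, φ => .all .base (mkAll n φ)

/-- Conjunction of a list of formulae. -/
def mkConj : List Fm → Fm
  | [] => .top
  | [A] => A
  | A :: As => .conj A (mkConj As)

/-- Extension of an environment by a ground coterm (for a de Bruijn binder). -/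
def consEnv {Sg : Sig} (t : GCoTerm Sg) (γ : ℕ → GCoTerm Sg) : ℕ → GCoTerm Sg
  | 0 => t
  | n + 1 => γ n

/-- Interpretation `⟦φ⟧_I` of formulae over a single interpretation
`I ⊆ 𝔅`, as a set of environments. -/
noncomputable def FmSemI {Sg : Sig} (sem : Tm → CoTerm Sg ℕ) (I : Set (HBase Sg)) :
    Fm → Set (ℕ → GCoTerm Sg)
  | .atom p Ms => {γ | (p, Ms.map fun M => csubst (sem M) γ) ∈ I}
  | .top => Set.univ
  | .conj φ ψ => FmSemI sem I φ ∩ FmSemI sem I ψ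
  | .disj φ ψ => FmSemI sem I φ ∪ FmSemI sem I ψ
  | .impl φ ψ => {γ | γ ∈ FmSemI sem I φ → γ ∈ FmSemI sem I ψ}
  | .all _ φ => {γ | ∀ t, consEnv t γ ∈ FmSemI sem I φ}
  | .ex _ φ => {γ | ∃ t, consEnv t γ ∈ FmSemI sem I φ}
  | .later φ => FmSemI sem I φ

/-- The formula corresponding to an atom. -/
def Atm.toFm (A : Atm) : Fm := .atom A.p A.args

/-- The `H^g`-formula `∀x⃗. A₁ ∧ … ∧ A_q → A₀` corresponding to a clause. -/
def HClause.toFm (C : HClause) : Fm :=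
  mkAll C.n (.impl (mkConj (C.body.map Atm.toFm)) C.head.toFm)

/-! ## Descending chains of interpretations and chain semantics of formulae -/

/-- The later modality on descending chains: `(▷u) α = ⋂_{β<α} u β`. -/
def laterC {X : Type*} (u : Ordinal → Set X) : Ordinal → Set X :=
  fun α => ⋂ β < α, u β

/-- The chain exponent: `(v ⇒̇ u) α = ⋂_{β≤α} { x | x ∈ v β → x ∈ u β }`. -/
def expC {X : Type*} (v u : Ordinal → Set X) : Ordinal → Set X :=
  fun α => ⋂ β ≤ α, {x | x ∈ v β → x ∈ u β}

/-- Interpretation `⟦φ⟧_u` of `iFOLm` formulae over a descending chain of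
interpretations `u`, as a descending chain of sets of environments:
atoms pointwise by preimage; `⊤`, `∧`, `∨`, `∀`, `∃` pointwise; implication by
the chain exponent; and `▷` by the later modality. -/
noncomputable def FmSemC {Sg : Sig} (sem : Tm → CoTerm Sg ℕ)
    (u : Ordinal → Set (HBase Sg)) : Fm → Ordinal → Set (ℕ → GCoTerm Sg)
  | .atom p Ms => fun α => {γ | (p, Ms.map fun M => csubst (sem M) γ) ∈ u α}
  | .top => fun _ => Set.univ
  | .conj φ ψ => fun α => FmSemC sem u φ α ∩ FmSemC sem u ψ α
  | .disj φ ψ => fun α => FmSemC sem u φ α ∪ FmSemC sem u ψ α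
  | .impl φ ψ => expC (FmSemC sem u φ) (FmSemC sem u ψ)
  | .all _ φ => fun α => {γ | ∀ t, consEnv t γ ∈ FmSemC sem u φ α}
  | .ex _ φ => fun α => {γ | ∃ t, consEnv t γ ∈ FmSemC sem u φ α}
  | .later φ => laterC (FmSemC sem u φ)

/-- Implication-free first-order formulae (no `→`, no `▷`, fix-free atoms). -/
inductive ImplFree : Fm → Prop
  | atom {p Ms} : (∀ M ∈ Ms, Tm.NoFix M) → ImplFree (.atom p Ms)
  | top : ImplFree .top
  | conj {φ ψ} : ImplFree φ → ImplFree ψ → ImplFree (.conj φ ψ)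
  | disj {φ ψ} : ImplFree φ → ImplFree ψ → ImplFree (.disj φ ψ)
  | all {τ φ} : ImplFree φ → ImplFree (.all τ φ)
  | ex {τ φ} : ImplFree φ → ImplFree (.ex τ φ)

/-- First-order goals: goal formulae built from first-order atoms by
`∧`, `∨`, `→`, `∀`, `∃`, with only implication-free formulae on the left of
an implication. -/
inductive FOGoal : Fm → Prop
  | atom {p Ms} : (∀ M ∈ Ms, Tm.NoFix M) → FOGoal (.atom p Ms)
  | top : FOGoal .top
  | conj {φ ψ} : FOGoal φ → FOGoal ψ → FOGoal (.conj φ ψ)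
  | disj {φ ψ} : FOGoal φ → FOGoal ψ → FOGoal (.disj φ ψ)
  | impl {φ ψ} : ImplFree φ → FOGoal ψ → FOGoal (.impl φ ψ)
  | all {τ φ} : FOGoal φ → FOGoal (.all τ φ)
  | ex {τ φ} : FOGoal φ → FOGoal (.ex τ φ)

theorem implFree_sem {Sg : Sig} (sem : Tm → CoTerm Sg ℕ) (c : Ordinal → Set (HBase Sg))
    (α : Ordinal) (I : Set (HBase Sg)) (hI : c α = I) {φ : Fm} (hφ : ImplFree φ) :
    FmSemC sem c φ α = FmSemI sem I φ := by
  induction hφ with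
  | atom _ => simp only [FmSemC, FmSemI, hI]
  | top => rfl
  | conj _ _ h1 h2 => simp only [FmSemC, FmSemI, h1, h2]
  | disj _ _ h1 h2 => simp only [FmSemC, FmSemI, h1, h2]
  | all _ h1 => simp only [FmSemC, FmSemI, h1]
  | ex _ h1 => simp only [FmSemC, FmSemI, h1]

theorem foGoal_sem {Sg : Sig} (sem : Tm → CoTerm Sg ℕ) (c : Ordinal → Set (HBase Sg))
    (α : Ordinal) (I : Set (HBase Sg)) (hI : c α = I) {φ : Fm} (hφ : FOGoal φ) :
    FmSemC sem c φ α ⊆ FmSemI sem I φ := by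
  induction hφ with
  | atom _ => simp only [FmSemC, FmSemI, hI]; exact subset_rfl
  | top => exact subset_rfl
  | conj _ _ h1 h2 => exact Set.inter_subset_inter h1 h2
  | disj _ _ h1 h2 => exact Set.union_subset_union h1 h2
  | impl hi _ h2 =>
    intro γ hγ hγ1
    have h3 := Set.mem_iInter₂.1 hγ α le_rfl
    exact h2 (h3 (by rw [implFree_sem sem c α I hI hi]; exact hγ1))
  | all _ h1 => exact fun γ hγ t => h1 (hγ t)
  | ex _ h1 => exact fun γ ⟨t, ht⟩ => ⟨t, h1 ht⟩

theorem chain_reaches {Sg : Sig} (sem : Tm → CoTerm Sg ℕ) (P : Set HClause)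
    (c : Ordinal → Set (HBase Sg)) (hc : ∀ α, c α = ⋂ β < α, PhiP P sem (c β)) :
    ∃ α, c α = HModel P sem := by
  have hlow : ∀ α, HModel P sem ⊆ c α := by
    intro α
    induction α using WellFoundedLT.induction with
    | ind α ih =>
      rw [hc α]
      refine Set.subset_iInter₂ fun β hβ => ?_
      have e : PhiP P sem (HModel P sem) = HModel P sem :=
        OrderHom.map_gfp ⟨PhiP P sem, PhiP_mono P sem⟩
      rw [← e]
      exact PhiP_mono P sem (ih β hβ)
  have key : ∀ β α, β < α → c β = c α → c α = HModel P sem := by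
    intro β α hlt he
    refine Set.Subset.antisymm ?_ (hlow α)
    refine OrderHom.le_gfp ⟨PhiP P sem, PhiP_mono P sem⟩ ?_
    change c α ⊆ PhiP P sem (c α)
    intro x hx
    rw [hc α] at hx
    have := Set.mem_iInter₂.1 hx β hlt
    rwa [he] at this
  have hn := not_injective_of_ordinal c
  simp only [Function.Injective, not_forall] at hn
  obtain ⟨a, b, he, hne⟩ := hn
  rcases lt_or_gt_of_ne hne with hl | hl
  · exact ⟨b, key a b hl he⟩
  · exact ⟨a, key b a hl he.symm⟩

/-- **From the chain model to the complete Herbrand model**: if `φ` is a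
first-order goal formula and its interpretation over the descending chain
`↓Φ_P` is the top chain, then its interpretation in the complete Herbrand
model `M(P)` (the greatest fixed point of `Φ_P`) is true. -/
theorem chain_sound_for_herbrand (Sg : Sig) (Pg : PSig) (hSg : Sg.FirstOrder)
    (sem : Tm → CoTerm Sg ℕ) (hsem : SemSpec Sg sem)
    (P : Set HClause) (hP : ∀ C ∈ P, C.WFh Sg Pg)
    (c : Ordinal → Set (HBase Sg))
    (hc : ∀ α, c α = ⋂ β < α, PhiP P sem (c β))
    (φ : Fm) (hφ : FOGoal φ)
    (h : ∀ α, FmSemC sem c φ α = Set.univ) :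
    FmSemI sem (HModel P sem) φ = Set.univ := by
  obtain ⟨α, hα⟩ := chain_reaches sem P c hc
  refine Set.eq_univ_of_univ_subset ?_
  rw [← h α]
  exact foGoal_sem sem c α _ hα hφ
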